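/- arXiv:2410.07409 — 4 statements merged into one kernel-verified Lean document; each statement's English description precedes it below -/
import Mathlib

section
/- Let X be a type, N a positive natural number, and φ : (Fin N → X) → ℝ a function invariant under all permutations of Fin N fixing the index 0. For each j : Fin N let swap(0,j) denote the transposition of 0 and j. Then the quantity ∑_{j ∈ Fin N} exp(φ(x ∘ swap(0,j))) is invariant under every permutation of Fin N: for all permutations τ of Fin N and all x : Fin N → X, ∑_{j} exp(φ((x ∘ τ) ∘ swap(0,j))) = ∑_{j} exp(φ(x ∘ swap(0,j))). -/
/-- If `φ` is invariant under all permutations of `Fin N` fixing index `0`, then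
the softmax denominator `∑_j exp(φ(x ∘ swap 0 j))` is invariant under every permutation of
`Fin N`. -/
theorem softmax_denominator_invariant
    {X : Type*} (N : ℕ) [NeZero N]
    (φ : (Fin N → X) → ℝ)
    (hinv : ∀ τ : Equiv.Perm (Fin N), τ 0 = 0 → ∀ x : Fin N → X, φ (x ∘ τ) = φ x) :
    ∀ τ : Equiv.Perm (Fin N), ∀ x : Fin N → X,
      ∑ j : Fin N, Real.exp (φ ((x ∘ τ) ∘ Equiv.swap 0 j))
        = ∑ j : Fin N, Real.exp (φ (x ∘ Equiv.swap 0 j)) := by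
  intro τ x
  refine Fintype.sum_equiv τ _ _ fun j => ?_
  rw [← hinv (Equiv.swap 0 (τ j) * τ * Equiv.swap 0 j) (by simp) (x ∘ Equiv.swap 0 (τ j))]
  congr 2
  ext i
  simp
end

section
/- Let X be a type, N a positive natural number, and φ̃ : (Fin N → X) → ℝ an arbitrary function. Define φ(x) = ∑_{σ ∈ P₁} φ̃(x ∘ σ), where P₁ is the set of permutations of Fin N fixing index 0, and define γ_i(x) = exp(φ(x ∘ swap(0,i))) / ∑_{j ∈ Fin N} exp(φ(x ∘ swap(0,j))). Then for every index i and every permutation τ of Fin N with τ(i) = i, γ_i(x ∘ τ) = γ_i(x); that is, agent i's responsibility allocation is invariant under any relabeling of the other agents. -/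
/-- Summing `f (x ∘ σ)` over the stabilizer of `i₀` gives a function of `x ∘ a` that depends on
the permutation `a` only through `a i₀`. -/
theorem sum_stabilizer_comp_congr {ι X M : Type*} [Fintype ι] [DecidableEq ι] [AddCommMonoid M]
    (f : (ι → X) → M) (x : ι → X) (i₀ : ι) {a b : Equiv.Perm ι} (h : a i₀ = b i₀) :
    ∑ σ ∈ Finset.univ.filter (fun σ : Equiv.Perm ι => σ i₀ = i₀), f ((x ∘ a) ∘ σ) =
      ∑ σ ∈ Finset.univ.filter (fun σ : Equiv.Perm ι => σ i₀ = i₀), f ((x ∘ b) ∘ σ) := by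
  refine Finset.sum_equiv (Equiv.mulLeft (b⁻¹ * a)) (fun σ => ?_) (fun σ _ => ?_)
  · have hfix : (b⁻¹ * a) i₀ = i₀ := by simp [h]
    simp only [Finset.mem_filter, Finset.mem_univ, true_and, Equiv.coe_mulLeft,
      Equiv.Perm.mul_apply (b⁻¹ * a) σ]
    rw [← (b⁻¹ * a).injective.eq_iff, hfix]
  · congr 1
    ext k
    simp

/-- With `φ(x) = ∑_{σ ∈ P₁} φ̃(x ∘ σ)` and
`γ_i(x) = exp(φ(x ∘ swap 0 i)) / ∑_j exp(φ(x ∘ swap 0 j))`, agent `i`'s responsibility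
allocation is invariant under any permutation `τ` fixing `i` (property (12)). -/
theorem gamma_symmetry
    {X : Type*} (N : ℕ) [NeZero N]
    (φt : (Fin N → X) → ℝ)
    (φ : (Fin N → X) → ℝ)
    (hφ : ∀ x : Fin N → X,
      φ x = ∑ σ ∈ Finset.univ.filter (fun σ : Equiv.Perm (Fin N) => σ 0 = 0), φt (x ∘ σ))
    (γ : Fin N → (Fin N → X) → ℝ)
    (hγ : ∀ (i : Fin N) (x : Fin N → X),
      γ i x = Real.exp (φ (x ∘ Equiv.swap 0 i))
        / ∑ j : Fin N, Real.exp (φ (x ∘ Equiv.swap 0 j))) :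
    ∀ (i : Fin N) (τ : Equiv.Perm (Fin N)), τ i = i → ∀ x : Fin N → X,
      γ i (x ∘ τ) = γ i x := by
  intro i τ hτ x
  have key (j : Fin N) : φ ((x ∘ τ) ∘ Equiv.swap 0 j) = φ (x ∘ Equiv.swap 0 (τ j)) := by
    rw [hφ, hφ]
    exact sum_stabilizer_comp_congr φt x 0 (a := τ * Equiv.swap 0 j) (b := Equiv.swap 0 (τ j))
      (by simp)
  simp only [hγ, key, hτ]
  rw [Equiv.sum_comp τ fun j => Real.exp (φ (x ∘ Equiv.swap 0 j))]
end

section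
/- Let X be a type, N a positive natural number, and φ̃ : (Fin N → X) → ℝ an arbitrary function. Define φ(x) = ∑_{σ ∈ P₁} φ̃(x ∘ σ), where P₁ is the set of permutations of Fin N fixing index 0, and define γ_i(x) = exp(φ(x ∘ swap(0,i))) / ∑_{j ∈ Fin N} exp(φ(x ∘ swap(0,j))). Then γ = (γ_1, ..., γ_N) is a symmetric responsibility allocation; that is, simultaneously: (i) γ_i(x ∘ τ) = γ_i(x) for every permutation τ of Fin N fixing index i; (ii) γ_i(x) = γ_j(x ∘ swap(i,j)) for all i, j; and (iii) ∑_{i ∈ Fin N} γ_i(x) = 1, for all x : Fin N → X. -/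
open Equiv in
/-- A function symmetrized over the stabilizer of `a` is invariant under that stabilizer. -/
theorem sum_perm_fixing_comp {ι X M : Type*} [Fintype ι] [DecidableEq ι] [AddCommMonoid M]
    (f : (ι → X) → M) (a : ι) (τ : Perm ι) (hτ : τ a = a) (x : ι → X) :
    ∑ σ ∈ Finset.univ.filter (fun σ : Perm ι => σ a = a), f ((x ∘ τ) ∘ σ) =
      ∑ σ ∈ Finset.univ.filter (fun σ : Perm ι => σ a = a), f (x ∘ σ) := by
  refine Finset.sum_equiv (Equiv.mulLeft τ) (fun σ => ?_) (fun σ _ => rfl)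
  have h : τ (σ a) = a ↔ σ a = a := by
    rw [← τ.injective.eq_iff (a := σ a), hτ]
  simp [h]

open Equiv in
/-- If `f` is invariant under the stabilizer of `a`, then `f (x ∘ τ ∘ swap a i)` depends on `τ`
only through `τ i`. -/
theorem apply_comp_perm_comp_swap {ι X M : Type*} [DecidableEq ι] (f : (ι → X) → M) (a : ι)
    (hf : ∀ τ : Perm ι, τ a = a → ∀ x : ι → X, f (x ∘ τ) = f x)
    (τ : Perm ι) (i : ι) (x : ι → X) :
    f ((x ∘ τ) ∘ swap a i) = f (x ∘ swap a (τ i)) := by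
  rw [← hf (swap a (τ i) * τ * swap a i) (by simp) (x ∘ swap a (τ i))]
  congr 1
  ext k
  simp

/-- paper's Proposition: With `φ(x) = ∑_{σ ∈ P₁} φ̃(x ∘ σ)` and
`γ_i(x) = exp(φ(x ∘ swap 0 i)) / ∑_j exp(φ(x ∘ swap 0 j))`, the vector `γ` is a symmetric
responsibility allocation: (i) `γ_i(x ∘ τ) = γ_i(x)` for every permutation `τ` fixing `i`;
(ii) `γ_i(x) = γ_j(x ∘ swap i j)` for all `i, j`; and (iii) `∑_i γ_i(x) = 1`. -/
theorem gamma_is_symmetric_responsibility_allocation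
    {X : Type*} (N : ℕ) [NeZero N]
    (φt : (Fin N → X) → ℝ)
    (φ : (Fin N → X) → ℝ)
    (hφ : ∀ x : Fin N → X,
      φ x = ∑ σ ∈ Finset.univ.filter (fun σ : Equiv.Perm (Fin N) => σ 0 = 0), φt (x ∘ σ))
    (γ : Fin N → (Fin N → X) → ℝ)
    (hγ : ∀ (i : Fin N) (x : Fin N → X),
      γ i x = Real.exp (φ (x ∘ Equiv.swap 0 i))
        / ∑ j : Fin N, Real.exp (φ (x ∘ Equiv.swap 0 j))) :
    (∀ (i : Fin N) (τ : Equiv.Perm (Fin N)), τ i = i → ∀ x : Fin N → X,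
        γ i (x ∘ τ) = γ i x)
    ∧ (∀ (i j : Fin N) (x : Fin N → X), γ i x = γ j (x ∘ Equiv.swap i j))
    ∧ (∀ x : Fin N → X, ∑ i : Fin N, γ i x = 1) := by
  have hinv : ∀ τ : Equiv.Perm (Fin N), τ 0 = 0 → ∀ x : Fin N → X, φ (x ∘ τ) = φ x :=
    fun τ hτ x => by rw [hφ, hφ, sum_perm_fixing_comp φt 0 τ hτ x]
  have hequiv : ∀ (τ : Equiv.Perm (Fin N)) (i : Fin N) (x : Fin N → X),
      γ i (x ∘ τ) = γ (τ i) x := fun τ i x => by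
    simp only [hγ, apply_comp_perm_comp_swap φ 0 hinv τ]
    rw [Equiv.sum_comp τ fun j => Real.exp (φ (x ∘ Equiv.swap 0 j))]
  refine ⟨fun i τ hτ x => by rw [hequiv, hτ], fun i j x => ?_, fun x => ?_⟩
  · rw [hequiv, Equiv.swap_apply_right]
  · simp only [hγ]
    rw [← Finset.sum_div]
    exact div_self (Finset.sum_pos (fun _ _ => Real.exp_pos _) Finset.univ_nonempty).ne'
end

section
/- Let X be a type, N a positive natural number, and φ̃ : (Fin N → X) → ℝ an arbitrary function. Define φ(x) = ∑_{σ ∈ P₁} φ̃(x ∘ σ), where P₁ is the set of permutations of Fin N fixing index 0, and define γ_i(x) = exp(φ(x ∘ swap(0,i))) / ∑_{j ∈ Fin N} exp(φ(x ∘ swap(0,j))). Then for every permutation τ of Fin N, every index i, and every x : Fin N → X, γ_{τ(i)}(x) = γ_i(x ∘ τ); that is, the responsibility allocation vector is equivariant under arbitrary relabelings of the agents. -/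
/-- Summing a function over all relabelings by permutations fixing `a` yields a function invariant
under such relabelings. -/
theorem sum_comp_perm_fixing_invariant {α X M : Type*} [Fintype α] [DecidableEq α]
    [AddCommMonoid M] (f : (α → X) → M) {a : α} {ρ : Equiv.Perm α} (hρ : ρ a = a) (x : α → X) :
    ∑ σ ∈ Finset.univ.filter (fun σ : Equiv.Perm α => σ a = a), f ((x ∘ ρ) ∘ σ) =
      ∑ σ ∈ Finset.univ.filter (fun σ : Equiv.Perm α => σ a = a), f (x ∘ σ) := by
  refine Finset.sum_equiv (Equiv.mulLeft ρ) (fun σ => ?_) (fun σ _ => rfl)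
  simp only [Finset.mem_filter, Finset.mem_univ, true_and, Equiv.coe_mulLeft,
    Equiv.Perm.mul_apply]
  rw [← ρ.injective.eq_iff (a := σ a), hρ]

/-- With `φ(x) = ∑_{σ ∈ P₁} φ̃(x ∘ σ)` and
`γ_i(x) = exp(φ(x ∘ swap 0 i)) / ∑_j exp(φ(x ∘ swap 0 j))`, the responsibility allocation
vector is equivariant under arbitrary relabelings of the agents:
`γ_{τ(i)}(x) = γ_i(x ∘ τ)` for every permutation `τ`. -/
theorem gamma_permutation_equivariant
    {X : Type*} (N : ℕ) [NeZero N]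
    (φt : (Fin N → X) → ℝ)
    (φ : (Fin N → X) → ℝ)
    (hφ : ∀ x : Fin N → X,
      φ x = ∑ σ ∈ Finset.univ.filter (fun σ : Equiv.Perm (Fin N) => σ 0 = 0), φt (x ∘ σ))
    (γ : Fin N → (Fin N → X) → ℝ)
    (hγ : ∀ (i : Fin N) (x : Fin N → X),
      γ i x = Real.exp (φ (x ∘ Equiv.swap 0 i))
        / ∑ j : Fin N, Real.exp (φ (x ∘ Equiv.swap 0 j))) :
    ∀ (τ : Equiv.Perm (Fin N)) (i : Fin N) (x : Fin N → X),
      γ (τ i) x = γ i (x ∘ τ) := by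
  intro τ i x
  have key (k : Fin N) : φ ((x ∘ τ) ∘ Equiv.swap 0 k) = φ (x ∘ Equiv.swap 0 (τ k)) := by
    let ρ : Equiv.Perm (Fin N) := Equiv.swap 0 (τ k) * τ * Equiv.swap 0 k
    have hρ : ρ 0 = 0 := by simp [ρ]
    have hx : (x ∘ τ) ∘ Equiv.swap 0 k = (x ∘ Equiv.swap 0 (τ k)) ∘ ρ := by
      ext j
      simp [ρ]
    rw [hx, hφ, hφ, sum_comp_perm_fixing_invariant φt hρ]
  simp only [hγ, key]
  rw [Equiv.sum_comp τ fun j => Real.exp (φ (x ∘ Equiv.swap 0 j))]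
end
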